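/- Suppose for each n, the functions g_n, h_n : [0,1] → ℝ are C² with |g_n''| ≤ K and |h_n''| ≤ K uniformly in n, and set ε_n = ν(g_n − S_n g_n) + k(S_n h_n − h_n), where S_n denotes the n-th partial Fourier–Legendre sum on [0,1] and ν, k > 0. Then ‖ε_n‖_{L²[0,1]} ≤ (ν + k) · (√3 K / (2√2)) · (Σ_{i=n}^∞ 1/(2i−3)⁴)^{1/2}, and in particular ‖ε_n‖_{L²} → 0 as n → ∞. -/

import Mathlib

open Filter

/-- The Legendre polynomials, via the three-term recurrence. -/
noncomputable def legendreP : ℕ → ℝ → ℝ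
  | 0, _ => 1
  | 1, x => x
  | n + 2, x =>
      ((2 * (n : ℝ) + 3) * x * legendreP (n + 1) x - ((n : ℝ) + 1) * legendreP n x) /
        ((n : ℝ) + 2)

/-- The Legendre scaling functions on `[0,1]`. -/
noncomputable def legendreScaling (i : ℕ) (x : ℝ) : ℝ :=
  Real.sqrt (2 * i + 1) * legendreP i (2 * x - 1)

/-- The `n`-th partial Fourier sum with respect to the Legendre scaling functions. -/
noncomputable def legendrePartialSum (n : ℕ) (f : ℝ → ℝ) (x : ℝ) : ℝ :=
  ∑ i ∈ Finset.range n, (∫ t in (0:ℝ)..1, f t * legendreScaling i t) * legendreScaling i x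

/-- Recursive form of the derivative of the Legendre polynomials. -/
noncomputable def legD : ℕ → ℝ → ℝ
  | 0, _ => 0
  | n + 1, x => x * legD n x + ((n : ℝ) + 1) * legendreP n x

lemma legP_zero (x : ℝ) : legendreP 0 x = 1 := by simp [legendreP]

lemma legP_one (x : ℝ) : legendreP 1 x = x := by simp [legendreP]

lemma legP_rec (n : ℕ) (x : ℝ) : ((n : ℝ) + 2) * legendreP (n + 2) x =
    (2 * (n : ℝ) + 3) * x * legendreP (n + 1) x - ((n : ℝ) + 1) * legendreP n x := by
  rw [legendreP]
  have : (n : ℝ) + 2 ≠ 0 := by positivity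
  field_simp

lemma legD_succ (n : ℕ) (x : ℝ) :
    legD (n + 1) x = x * legD n x + ((n : ℝ) + 1) * legendreP n x := by
  rw [legD]

lemma legD_B (n : ℕ) (x : ℝ) :
    x * legD (n + 1) x - legD n x = ((n : ℝ) + 1) * legendreP (n + 1) x := by
  induction n with
  | zero => simp [legD, legendreP]
  | succ n ih =>
    have h1 := legD_succ n x
    have h2 := legD_succ (n + 1) x
    have h3 := legP_rec n x
    push_cast at *
    rw [h2]
    linear_combination (-1) * h3 + x * ih - h1

lemma legD_diff (n : ℕ) (x : ℝ) :
    legD (n + 2) x - legD n x = (2 * (n : ℝ) + 3) * legendreP (n + 1) x := by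
  have h1 := legD_B n x
  have h2 := legD_succ (n + 1) x
  push_cast at *
  linear_combination h1 + h2

lemma legP_hasDerivAt_pair (n : ℕ) (x : ℝ) :
    HasDerivAt (legendreP n) (legD n x) x ∧
      HasDerivAt (legendreP (n + 1)) (legD (n + 1) x) x := by
  induction n with
  | zero =>
    constructor
    · have : legendreP 0 = fun _ => (1 : ℝ) := by funext y; exact legP_zero y
      rw [this]; simpa [legD] using hasDerivAt_const x (1 : ℝ)
    · have : legendreP 1 = fun y => y := by funext y; exact legP_one y
      simp only [zero_add]
      rw [this]; simpa [legD, legendreP] using hasDerivAt_id' x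
  | succ n ih =>
    refine ⟨ih.2, ?_⟩
    have h := ((((hasDerivAt_id' x).const_mul (2 * (n : ℝ) + 3)).mul ih.2).sub
      (ih.1.const_mul ((n : ℝ) + 1))).div_const ((n : ℝ) + 2)
    have e : legendreP (n + 1 + 1) = fun x => ((2 * (n : ℝ) + 3) * x * legendreP (n + 1) x -
        ((n : ℝ) + 1) * legendreP n x) / ((n : ℝ) + 2) := by
      funext y; rw [legendreP]
    rw [e]
    refine h.congr_deriv ?_
    have h1 := legD_B n x
    have h2 := legD_succ (n + 1) x
    have : (n : ℝ) + 2 ≠ 0 := by positivity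
    rw [div_eq_iff this]
    push_cast at *
    linear_combination (-((n : ℝ) + 2)) * h2 + ((n : ℝ) + 1) * h1

lemma legP_hasDerivAt (n : ℕ) (x : ℝ) : HasDerivAt (legendreP n) (legD n x) x :=
  (legP_hasDerivAt_pair n x).1

/-- Legendre differential equation. -/
lemma legP_ode (n : ℕ) (x : ℝ) :
    HasDerivAt (fun y => (y ^ 2 - 1) * legD n y) ((n : ℝ) * (n + 1) * legendreP n x) x := by
  cases n with
  | zero => simpa [legD] using hasDerivAt_const x (0 : ℝ)
  | succ n =>
    have e : (fun y => (y ^ 2 - 1) * legD (n + 1) y) =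
        fun y => ((n : ℝ) + 1) * (y * legendreP (n + 1) y - legendreP n y) := by
      funext y
      have h1 := legD_B n y
      have h2 := legD_succ n y
      linear_combination y * h1 - h2
    rw [e]
    refine ((((hasDerivAt_id' x).mul (legP_hasDerivAt (n + 1) x)).sub
      (legP_hasDerivAt n x)).const_mul ((n : ℝ) + 1)).congr_deriv ?_
    have h1 := legD_B n x
    push_cast
    linear_combination ((n : ℝ) + 1) * h1

lemma legP_continuous (n : ℕ) : Continuous (legendreP n) :=
  continuous_iff_continuousAt.2 fun x => (legP_hasDerivAt n x).continuousAt

/-- Shifted Legendre polynomial. -/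
noncomputable def legQ (n : ℕ) (t : ℝ) : ℝ := legendreP n (2 * t - 1)

lemma legQ_continuous (n : ℕ) : Continuous (legQ n) :=
  (legP_continuous n).comp (by fun_prop)

lemma lin_hasDerivAt (t : ℝ) : HasDerivAt (fun t : ℝ => 2 * t - 1) 2 t := by
  simpa using ((hasDerivAt_id' t).const_mul 2).sub_const 1

lemma legQ_hasDerivAt (n : ℕ) (t : ℝ) :
    HasDerivAt (legQ n) (2 * legD n (2 * t - 1)) t := by
  have := (legP_hasDerivAt n (2 * t - 1)).comp t (lin_hasDerivAt t)
  exact this.congr_deriv (by ring)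

lemma legQ_orth {m n : ℕ} (hmn : m ≠ n) : ∫ t in (0:ℝ)..1, legQ m t * legQ n t = 0 := by
  have key : ∀ t ∈ Set.uIcc (0:ℝ) 1, HasDerivAt
      (fun t => (((2 * t - 1) ^ 2 - 1) * legD m (2 * t - 1)) * legQ n t -
        (((2 * t - 1) ^ 2 - 1) * legD n (2 * t - 1)) * legQ m t)
      (2 * ((m : ℝ) * (m + 1) - n * (n + 1)) * (legQ m t * legQ n t)) t := by
    intro t _
    have hm := (legP_ode m (2 * t - 1)).comp t (lin_hasDerivAt t)
    have hn := (legP_ode n (2 * t - 1)).comp t (lin_hasDerivAt t)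
    refine ((hm.mul (legQ_hasDerivAt n t)).sub (hn.mul (legQ_hasDerivAt m t))).congr_deriv ?_
    simp only [legQ, Function.comp]
    ring
  have hc : Continuous fun t => 2 * ((m : ℝ) * (m + 1) - n * (n + 1)) * (legQ m t * legQ n t) := by
    have := legQ_continuous m
    have := legQ_continuous n
    fun_prop
  have h := intervalIntegral.integral_eq_sub_of_hasDerivAt key (hc.intervalIntegrable 0 1)
  rw [intervalIntegral.integral_const_mul] at h
  norm_num at h
  rcases h with h | h
  · exfalso
    have h2 : ((m : ℝ) - n) * (m + n + 1) = 0 := by linear_combination h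
    rcases mul_eq_zero.1 h2 with h3 | h3
    · exact hmn (by exact_mod_cast sub_eq_zero.1 h3)
    · have : (0:ℝ) < m + n + 1 := by positivity
      linarith
  · exact h

lemma legQ_rec (n : ℕ) (t : ℝ) : ((n : ℝ) + 2) * legQ (n + 2) t =
    (2 * (n : ℝ) + 3) * (2 * t - 1) * legQ (n + 1) t - ((n : ℝ) + 1) * legQ n t :=
  legP_rec n _

lemma legQ_norm_one : ∫ t in (0:ℝ)..1, legQ 1 t * legQ 1 t = 1 / 3 := by
  have key : ∀ t ∈ Set.uIcc (0:ℝ) 1, HasDerivAt (fun t : ℝ => (2 * t - 1) ^ 3 / 6)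
      (legQ 1 t * legQ 1 t) t := by
    intro t _
    refine (((lin_hasDerivAt t).pow 3).div_const 6).congr_deriv ?_
    simp only [legQ, legP_one]
    norm_num
    ring
  have hc : Continuous fun t => legQ 1 t * legQ 1 t := (legQ_continuous 1).mul (legQ_continuous 1)
  rw [intervalIntegral.integral_eq_sub_of_hasDerivAt key (hc.intervalIntegrable 0 1)]
  norm_num

lemma legQ_norm_succ (n : ℕ) :
    ∫ t in (0:ℝ)..1, legQ (n + 1) t * legQ (n + 1) t = 1 / (2 * (n : ℝ) + 3) := by
  induction n with
  | zero => rw [zero_add, legQ_norm_one]; norm_num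
  | succ n ih =>
    have hcq := legQ_continuous
    have e1 : ((n : ℝ) + 2) * ∫ t in (0:ℝ)..1, legQ (n + 2) t * legQ (n + 2) t =
        (2 * (n : ℝ) + 3) * ∫ t in (0:ℝ)..1, (2 * t - 1) * legQ (n + 1) t * legQ (n + 2) t := by
      have : ∀ t, ((n : ℝ) + 2) * (legQ (n + 2) t * legQ (n + 2) t) =
          (2 * (n : ℝ) + 3) * ((2 * t - 1) * legQ (n + 1) t * legQ (n + 2) t) -
            ((n : ℝ) + 1) * (legQ n t * legQ (n + 2) t) := by
        intro t; linear_combination legQ (n + 2) t * legQ_rec n t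
      rw [← intervalIntegral.integral_const_mul, intervalIntegral.integral_congr
        (fun t _ => this t), intervalIntegral.integral_sub
          (Continuous.intervalIntegrable (by fun_prop) _ _)
          (Continuous.intervalIntegrable (by fun_prop) _ _),
        intervalIntegral.integral_const_mul, intervalIntegral.integral_const_mul,
        legQ_orth (by omega)]
      ring
    have e2 : (0 : ℝ) = (2 * (n : ℝ) + 5) *
        (∫ t in (0:ℝ)..1, (2 * t - 1) * legQ (n + 1) t * legQ (n + 2) t) -
          ((n : ℝ) + 2) * ∫ t in (0:ℝ)..1, legQ (n + 1) t * legQ (n + 1) t := by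
      have : ∀ t, ((n : ℝ) + 3) * (legQ (n + 3) t * legQ (n + 1) t) =
          (2 * (n : ℝ) + 5) * ((2 * t - 1) * legQ (n + 1) t * legQ (n + 2) t) -
            ((n : ℝ) + 2) * (legQ (n + 1) t * legQ (n + 1) t) := by
        intro t
        have h := legQ_rec (n + 1) t
        push_cast at h
        linear_combination legQ (n + 1) t * h
      have h3 : ((n : ℝ) + 3) * ∫ t in (0:ℝ)..1, legQ (n + 3) t * legQ (n + 1) t = 0 := by
        rw [legQ_orth (by omega), mul_zero]
      refine h3.symm.trans ?_
      rw [← intervalIntegral.integral_const_mul, intervalIntegral.integral_congr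
        (fun t _ => this t), intervalIntegral.integral_sub
          (Continuous.intervalIntegrable (by fun_prop) _ _)
          (Continuous.intervalIntegrable (by fun_prop) _ _),
        intervalIntegral.integral_const_mul, intervalIntegral.integral_const_mul]
    rw [ih] at e2
    have p1 : (2 * (n : ℝ) + 3) ≠ 0 := by positivity
    have p2 : (2 * (n : ℝ) + 5) ≠ 0 := by positivity
    have p3 : ((n : ℝ) + 2) ≠ 0 := by positivity
    have p4 : (2 * ((n + 1 : ℕ) : ℝ) + 3) ≠ 0 := by positivity
    rw [eq_div_iff p4]
    apply mul_left_cancel₀ p3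
    push_cast
    have e3 : (2 * (n : ℝ) + 3) * (1 / (2 * (n : ℝ) + 3)) = 1 := by field_simp
    linear_combination (2 * (n : ℝ) + 5) * e1 - (2 * (n : ℝ) + 3) * e2 + ((n : ℝ) + 2) * e3

lemma legQ_norm (n : ℕ) :
    ∫ t in (0:ℝ)..1, legQ n t * legQ n t = 1 / (2 * (n : ℝ) + 1) := by
  cases n with
  | zero => simp [legQ, legP_zero]
  | succ n => rw [legQ_norm_succ]; push_cast; ring_nf

lemma scaling_eq (i : ℕ) (t : ℝ) : legendreScaling i t = Real.sqrt (2 * i + 1) * legQ i t := rfl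

lemma scaling_continuous (i : ℕ) : Continuous (legendreScaling i) :=
  (legQ_continuous i).const_mul _

lemma scaling_orth {m n : ℕ} (hmn : m ≠ n) :
    ∫ t in (0:ℝ)..1, legendreScaling m t * legendreScaling n t = 0 := by
  have : ∀ t, legendreScaling m t * legendreScaling n t =
      Real.sqrt (2 * m + 1) * Real.sqrt (2 * n + 1) * (legQ m t * legQ n t) := by
    intro t; rw [scaling_eq, scaling_eq]; ring
  simp_rw [this]
  rw [intervalIntegral.integral_const_mul, legQ_orth hmn, mul_zero]

lemma scaling_norm (n : ℕ) :
    ∫ t in (0:ℝ)..1, legendreScaling n t * legendreScaling n t = 1 := by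
  have : ∀ t, legendreScaling n t * legendreScaling n t =
      (2 * (n : ℝ) + 1) * (legQ n t * legQ n t) := by
    intro t
    have h : Real.sqrt (2 * n + 1) * Real.sqrt (2 * n + 1) = 2 * (n : ℝ) + 1 :=
      Real.mul_self_sqrt (by positivity)
    rw [scaling_eq]
    linear_combination (legQ n t * legQ n t) * h
  simp_rw [this]
  rw [intervalIntegral.integral_const_mul, legQ_norm]
  have : (2 * (n : ℝ) + 1) ≠ 0 := by positivity
  field_simp

/-- Fourier-Legendre coefficient. -/
noncomputable def legC (f : ℝ → ℝ) (i : ℕ) : ℝ := ∫ t in (0:ℝ)..1, f t * legendreScaling i t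

lemma pyth_aux (f : ℝ → ℝ) (hf : Continuous f) (a : ℕ → ℝ) (m j : ℕ) (hj : m ≤ j) :
    ∫ t in (0:ℝ)..1, (f t - ∑ i ∈ Finset.range m, a i * legendreScaling i t) *
      legendreScaling j t = legC f j := by
  have hs := scaling_continuous
  induction m with
  | zero => simp [legC]
  | succ m ih =>
    rw [← ih (by omega)]
    have : ∀ t, (f t - ∑ i ∈ Finset.range (m + 1), a i * legendreScaling i t) *
      legendreScaling j t = (f t - ∑ i ∈ Finset.range m, a i * legendreScaling i t) *
      legendreScaling j t - a m * (legendreScaling m t * legendreScaling j t) := by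
      intro t; rw [Finset.sum_range_succ]; ring
    simp_rw [this]
    rw [intervalIntegral.integral_sub
          (Continuous.intervalIntegrable (by fun_prop) _ _)
          (Continuous.intervalIntegrable (by fun_prop) _ _),
        intervalIntegral.integral_const_mul, scaling_orth (by omega)]
    ring

lemma pyth (f : ℝ → ℝ) (hf : Continuous f) (a : ℕ → ℝ) (m : ℕ) :
    ∫ t in (0:ℝ)..1, (f t - ∑ i ∈ Finset.range m, a i * legendreScaling i t) ^ 2 =
      (∫ t in (0:ℝ)..1, f t ^ 2) + ∑ i ∈ Finset.range m, (a i ^ 2 - 2 * a i * legC f i) := by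
  have hs := scaling_continuous
  induction m with
  | zero => simp
  | succ m ih =>
    rw [Finset.sum_range_succ, ← add_assoc, ← ih]
    have : ∀ t, (f t - ∑ i ∈ Finset.range (m + 1), a i * legendreScaling i t) ^ 2 =
      (f t - ∑ i ∈ Finset.range m, a i * legendreScaling i t) ^ 2 -
      (2 * a m) * ((f t - ∑ i ∈ Finset.range m, a i * legendreScaling i t) *
        legendreScaling m t) + a m ^ 2 * (legendreScaling m t * legendreScaling m t) := by
      intro t; rw [Finset.sum_range_succ]; ring
    simp_rw [this]
    rw [intervalIntegral.integral_add
          (Continuous.intervalIntegrable (by fun_prop) _ _)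
          (Continuous.intervalIntegrable (by fun_prop) _ _),
        intervalIntegral.integral_sub
          (Continuous.intervalIntegrable (by fun_prop) _ _)
          (Continuous.intervalIntegrable (by fun_prop) _ _),
        intervalIntegral.integral_const_mul, intervalIntegral.integral_const_mul,
        scaling_norm, pyth_aux f hf a m m le_rfl]
    ring

lemma pyth_partial (f : ℝ → ℝ) (hf : Continuous f) (m : ℕ) :
    ∫ t in (0:ℝ)..1, (f t - legendrePartialSum m f t) ^ 2 =
      (∫ t in (0:ℝ)..1, f t ^ 2) - ∑ i ∈ Finset.range m, legC f i ^ 2 := by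
  have := pyth f hf (legC f) m
  simp only [legendrePartialSum]
  refine this.trans ?_
  rw [sub_eq_add_neg, ← Finset.sum_neg_distrib]
  congr 1
  refine Finset.sum_congr rfl fun i _ => by ring

lemma best_approx (f : ℝ → ℝ) (hf : Continuous f) (a : ℕ → ℝ) (m : ℕ) :
    (∫ t in (0:ℝ)..1, f t ^ 2) - ∑ i ∈ Finset.range m, legC f i ^ 2 ≤
    ∫ t in (0:ℝ)..1, (f t - ∑ i ∈ Finset.range m, a i * legendreScaling i t) ^ 2 := by
  rw [pyth f hf, sub_eq_add_neg, ← Finset.sum_neg_distrib]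
  gcongr with i _
  nlinarith [sq_nonneg (a i - legC f i)]

lemma legQ_mem (i : ℕ) : legQ i ∈ Submodule.span ℝ (Set.range legendreScaling) := by
  have h : legQ i = (Real.sqrt (2 * i + 1))⁻¹ • legendreScaling i := by
    funext t
    have : Real.sqrt (2 * i + 1) ≠ 0 := by positivity
    simp only [Pi.smul_apply, smul_eq_mul, scaling_eq]
    field_simp
  rw [h]
  exact Submodule.smul_mem _ _ (Submodule.subset_span ⟨i, rfl⟩)

lemma mul_legQ_mem (i : ℕ) :
    (fun t => t * legQ i t) ∈ Submodule.span ℝ (Set.range legendreScaling) := by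
  cases i with
  | zero =>
    have : (fun t => t * legQ 0 t) = (1 / 2 : ℝ) • (legQ 1 + legQ 0) := by
      funext t
      simp [legQ, legP_zero, legP_one]
    rw [this]
    exact Submodule.smul_mem _ _ (Submodule.add_mem _ (legQ_mem _) (legQ_mem _))
  | succ n =>
    have : (fun t => t * legQ (n + 1) t) = (1 / (2 * (2 * (n : ℝ) + 3))) •
        (((n : ℝ) + 2) • legQ (n + 2) + ((n : ℝ) + 1) • legQ n
          + (2 * (n : ℝ) + 3) • legQ (n + 1)) := by
      funext t
      have h := legQ_rec n t
      have : 2 * (2 * (n : ℝ) + 3) ≠ 0 := by positivity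
      simp only [Pi.smul_apply, Pi.add_apply, smul_eq_mul]
      rw [one_div, eq_inv_mul_iff_mul_eq₀ this]
      linear_combination -h
    rw [this]
    refine Submodule.smul_mem _ _ (Submodule.add_mem _ (Submodule.add_mem _ ?_ ?_) ?_) <;>
    exact Submodule.smul_mem _ _ (legQ_mem _)

lemma mul_mem_span (w : ℝ → ℝ) (hw : w ∈ Submodule.span ℝ (Set.range legendreScaling)) :
    (fun t => t * w t) ∈ Submodule.span ℝ (Set.range legendreScaling) := by
  induction hw using Submodule.span_induction with
  | mem x hx =>
    obtain ⟨i, rfl⟩ := hx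
    have : (fun t => t * legendreScaling i t) =
        Real.sqrt (2 * i + 1) • (fun t => t * legQ i t) := by
      funext t
      simp only [Pi.smul_apply, smul_eq_mul, scaling_eq]
      ring
    rw [this]
    exact Submodule.smul_mem _ _ (mul_legQ_mem i)
  | zero =>
    have : (fun t : ℝ => t * (0 : ℝ → ℝ) t) = 0 := by funext t; simp
    rw [this]; exact Submodule.zero_mem _
  | add x y _ _ hx hy =>
    have : (fun t : ℝ => t * (x + y) t) = (fun t => t * x t) + (fun t => t * y t) := by
      funext t; simp [mul_add]
    rw [this]; exact Submodule.add_mem _ hx hy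
  | smul a x _ hx =>
    have : (fun t : ℝ => t * (a • x) t) = a • (fun t => t * x t) := by
      funext t; simp; ring
    rw [this]; exact Submodule.smul_mem _ _ hx

lemma poly_mem_span (p : Polynomial ℝ) :
    (fun t => p.eval t) ∈ Submodule.span ℝ (Set.range legendreScaling) := by
  induction p using Polynomial.induction_on with
  | C a =>
    have : (fun t => (Polynomial.C a).eval t) = a • legQ 0 := by
      funext t; simp [legQ, legP_zero]
    rw [this]; exact Submodule.smul_mem _ _ (legQ_mem 0)
  | add p q hp hq =>
    have : (fun t => (p + q).eval t) = (fun t => p.eval t) + fun t => q.eval t := by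
      funext t; simp
    rw [this]; exact Submodule.add_mem _ hp hq
  | monomial n a h =>
    have : (fun t => (Polynomial.C a * Polynomial.X ^ (n + 1)).eval t) =
        fun t => t * (Polynomial.C a * Polynomial.X ^ n).eval t := by
      funext t; simp; ring
    rw [this]; exact mul_mem_span _ h

lemma poly_expand (p : Polynomial ℝ) : ∃ (m : ℕ) (a : ℕ → ℝ), ∀ t,
    p.eval t = ∑ i ∈ Finset.range m, a i * legendreScaling i t := by
  obtain ⟨c, hc⟩ := Finsupp.mem_span_range_iff_exists_finsupp.1 (poly_mem_span p)
  obtain ⟨m, hm⟩ := Finset.exists_nat_subset_range c.support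
  refine ⟨m, c, fun t => ?_⟩
  rw [Finsupp.sum_of_support_subset c hm _ (by simp)] at hc
  have := congrFun hc t
  simp only [Finset.sum_apply, Pi.smul_apply, smul_eq_mul] at this
  exact this.symm

lemma bessel_complete (f : ℝ → ℝ) (hf : Continuous f) (δ : ℝ) (hδ : 0 < δ) :
    ∃ m, (∫ t in (0:ℝ)..1, f t ^ 2) ≤ ∑ i ∈ Finset.range m, legC f i ^ 2 + δ := by
  obtain ⟨p, hp⟩ := exists_polynomial_near_of_continuousOn 0 1 f hf.continuousOn
    (Real.sqrt δ) (Real.sqrt_pos.2 hδ)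
  obtain ⟨m, a, ha⟩ := poly_expand p
  refine ⟨m, ?_⟩
  have h := best_approx f hf a m
  have hs := scaling_continuous
  have h2 : ∫ t in (0:ℝ)..1, (f t - ∑ i ∈ Finset.range m, a i * legendreScaling i t) ^ 2 ≤
      ∫ t in (0:ℝ)..1, δ := by
    apply intervalIntegral.integral_mono_on zero_le_one
      (Continuous.intervalIntegrable (by fun_prop) _ _)
      (Continuous.intervalIntegrable (by fun_prop) _ _)
    intro t ht
    have h3 := hp t ht
    rw [← ha, ← Real.sq_sqrt hδ.le, ← neg_sub, neg_sq]
    exact sq_le_sq' (by linarith [(abs_lt.1 h3).1]) (abs_lt.1 h3).2.le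
  simp at h2
  linarith

lemma legP_at_one (n : ℕ) : legendreP n 1 = 1 ∧ legendreP (n + 1) 1 = 1 := by
  induction n with
  | zero => simp [legP_zero, legP_one]
  | succ n ih =>
    refine ⟨ih.2, ?_⟩
    have h := legP_rec n 1
    rw [ih.1, ih.2] at h
    have : (n : ℝ) + 2 ≠ 0 := by positivity
    apply mul_left_cancel₀ this
    linear_combination h

lemma legP_at_neg_one (n : ℕ) :
    legendreP n (-1) = (-1) ^ n ∧ legendreP (n + 1) (-1) = (-1) ^ (n + 1) := by
  induction n with
  | zero => simp [legP_zero, legP_one]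
  | succ n ih =>
    refine ⟨ih.2, ?_⟩
    have h := legP_rec n (-1)
    rw [ih.1, ih.2] at h
    have : (n : ℝ) + 2 ≠ 0 := by positivity
    apply mul_left_cancel₀ this
    refine h.trans ?_
    ring

/-- Antiderivative of `legQ (n+1)`. -/
noncomputable def legR (n : ℕ) (t : ℝ) : ℝ := (legQ (n + 2) t - legQ n t) / (2 * (2 * n + 3))

/-- Antiderivative of `legR (n+1)`. -/
noncomputable def legT (n : ℕ) (t : ℝ) : ℝ := (legR (n + 2) t - legR n t) / (2 * (2 * n + 5))

lemma legR_hasDerivAt (n : ℕ) (t : ℝ) : HasDerivAt (legR n) (legQ (n + 1) t) t := by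
  refine (((legQ_hasDerivAt (n + 2) t).sub (legQ_hasDerivAt n t)).div_const
    (2 * (2 * n + 3))).congr_deriv ?_
  have h := legD_diff n (2 * t - 1)
  have : (2 * (2 * (n : ℝ) + 3)) ≠ 0 := by positivity
  rw [div_eq_iff this, legQ]
  linear_combination 2 * h

lemma legT_hasDerivAt (n : ℕ) (t : ℝ) : HasDerivAt (legT n) (legR (n + 1) t) t := by
  refine (((legR_hasDerivAt (n + 2) t).sub (legR_hasDerivAt n t)).div_const
    (2 * (2 * n + 5))).congr_deriv ?_
  rw [legR]
  push_cast
  ring_nf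

lemma legR_zero (n : ℕ) : legR n 0 = 0 := by
  simp [legR, legQ, (legP_at_neg_one n).1, (legP_at_neg_one (n + 2)).1, pow_add]

lemma legR_one (n : ℕ) : legR n 1 = 0 := by
  have e : (2 : ℝ) * 1 - 1 = 1 := by norm_num
  rw [legR, legQ, legQ, e, (legP_at_one n).1, (legP_at_one (n + 2)).1]
  simp

lemma legT_zero (n : ℕ) : legT n 0 = 0 := by simp [legT, legR_zero]

lemma legT_one (n : ℕ) : legT n 1 = 0 := by simp [legT, legR_one]

lemma legT_continuous (n : ℕ) : Continuous (legT n) :=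
  continuous_iff_continuousAt.2 fun x => (legT_hasDerivAt n x).continuousAt

lemma legT_norm (n : ℕ) : ∫ t in (0:ℝ)..1, legT n t ^ 2 ≤
    3 / (8 * (2 * (n : ℝ) + 5) ^ 2 * (2 * n + 3) ^ 2 * (2 * n + 1)) := by
  have hq := legQ_continuous
  set α : ℝ := 1 / (4 * (2 * n + 5) * (2 * n + 7)) with hα
  set γ : ℝ := 1 / (4 * (2 * n + 5) * (2 * n + 3)) with hγ
  have e : ∀ t, legT n t ^ 2 = α ^ 2 * (legQ (n + 4) t * legQ (n + 4) t) +
      (α + γ) ^ 2 * (legQ (n + 2) t * legQ (n + 2) t) + γ ^ 2 * (legQ n t * legQ n t) +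
      (-2 * α * (α + γ)) * (legQ (n + 4) t * legQ (n + 2) t) +
      (2 * α * γ) * (legQ (n + 4) t * legQ n t) +
      (-2 * γ * (α + γ)) * (legQ (n + 2) t * legQ n t) := by
    intro t
    have : legT n t = α * legQ (n + 4) t - (α + γ) * legQ (n + 2) t + γ * legQ n t := by
      simp only [legT, legR, hα, hγ]
      push_cast
      have : 2 * ((n : ℝ) + 2) + 3 = 2 * n + 7 := by ring
      rw [this]
      field_simp
      ring
    rw [this]; ring
  simp_rw [e]
  rw [intervalIntegral.integral_add
          (Continuous.intervalIntegrable (by fun_prop) _ _)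
          (Continuous.intervalIntegrable (by fun_prop) _ _),
      intervalIntegral.integral_add
          (Continuous.intervalIntegrable (by fun_prop) _ _)
          (Continuous.intervalIntegrable (by fun_prop) _ _),
      intervalIntegral.integral_add
          (Continuous.intervalIntegrable (by fun_prop) _ _)
          (Continuous.intervalIntegrable (by fun_prop) _ _),
      intervalIntegral.integral_add
          (Continuous.intervalIntegrable (by fun_prop) _ _)
          (Continuous.intervalIntegrable (by fun_prop) _ _),
      intervalIntegral.integral_add
          (Continuous.intervalIntegrable (by fun_prop) _ _)
          (Continuous.intervalIntegrable (by fun_prop) _ _)]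
  simp only [intervalIntegral.integral_const_mul, legQ_norm]
  rw [legQ_orth (show n + 4 ≠ n + 2 by omega), legQ_orth (show n + 4 ≠ n by omega),
    legQ_orth (show n + 2 ≠ n by omega)]
  push_cast
  have hα0 : 0 ≤ α := by positivity
  have hαγ : α ≤ γ := by
    rw [hα, hγ]; gcongr; norm_num
  have h1 : 1 / (2 * ((n : ℝ) + 4) + 1) ≤ 1 / (2 * n + 1) := by gcongr; norm_num
  have h2 : 1 / (2 * ((n : ℝ) + 2) + 1) ≤ 1 / (2 * n + 1) := by gcongr; norm_num
  have h0 : 0 < 1 / (2 * (n : ℝ) + 1) := by positivity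
  have g1 : α ^ 2 * (1 / (2 * ((n : ℝ) + 4) + 1)) ≤ γ ^ 2 * (1 / (2 * n + 1)) := by gcongr
  have g2 : (α + γ) ^ 2 * (1 / (2 * ((n : ℝ) + 2) + 1)) ≤ (γ + γ) ^ 2 * (1 / (2 * n + 1)) := by
    gcongr
  have g3 : 3 / (8 * (2 * (n : ℝ) + 5) ^ 2 * (2 * n + 3) ^ 2 * (2 * n + 1)) =
      6 * (γ ^ 2 * (1 / (2 * n + 1))) := by
    rw [hγ]; field_simp; norm_num
  rw [g3]
  linarith

lemma coeff_bound (f : ℝ → ℝ) (hf : ContDiff ℝ 2 f) (K : ℝ)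
    (hK : ∀ x ∈ Set.Icc (0:ℝ) 1, |iteratedDeriv 2 f x| ≤ K) (n : ℕ) :
    legC f (n + 2) ^ 2 ≤ 3 * K ^ 2 / 8 * (1 / (2 * (n : ℝ) + 1) ^ 4) := by
  have hfc : Continuous f := hf.continuous
  have hd1 : ContDiff ℝ 1 (deriv f) := by
    have : ContDiff ℝ (1 + 1) f := by simpa [one_add_one_eq_two] using hf
    exact (contDiff_succ_iff_deriv.1 this).2.2
  have hi : iteratedDeriv 2 f = deriv (deriv f) := by
    rw [iteratedDeriv_succ, iteratedDeriv_one]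
  rw [hi] at hK
  have hd2c : Continuous (deriv (deriv f)) := hd1.continuous_deriv (le_refl _)
  have hT := legT_continuous n
  have hq := legQ_continuous
  have key : ∀ t ∈ Set.uIcc (0:ℝ) 1, HasDerivAt
      (fun t => f t * legR (n + 1) t - deriv f t * legT n t)
      (f t * legQ (n + 2) t - deriv (deriv f) t * legT n t) t := by
    intro t _
    have a1 : HasDerivAt f (deriv f t) t := (hf.differentiable (by norm_num) t).hasDerivAt
    have a2 : HasDerivAt (deriv f) (deriv (deriv f) t) t :=
      (hd1.differentiable (by norm_num) t).hasDerivAt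
    refine ((a1.mul (legR_hasDerivAt (n + 1) t)).sub
      (a2.mul (legT_hasDerivAt n t))).congr_deriv ?_
    ring
  have h := intervalIntegral.integral_eq_sub_of_hasDerivAt key
    (Continuous.intervalIntegrable (by fun_prop) _ _)
  rw [intervalIntegral.integral_sub
          (Continuous.intervalIntegrable (by fun_prop) _ _)
          (Continuous.intervalIntegrable (by fun_prop) _ _)] at h
  simp only [legR_zero, legR_one, legT_zero, legT_one, mul_zero, sub_zero] at h
  set c := ∫ t in (0:ℝ)..1, deriv (deriv f) t * legT n t with hc
  set N := ∫ t in (0:ℝ)..1, legT n t ^ 2 with hN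
  set A := ∫ t in (0:ℝ)..1, deriv (deriv f) t ^ 2 with hA
  have hA' : A ≤ K ^ 2 := by
    have : A ≤ ∫ t in (0:ℝ)..1, K ^ 2 := by
      apply intervalIntegral.integral_mono_on zero_le_one
        (Continuous.intervalIntegrable (by fun_prop) _ _)
        (Continuous.intervalIntegrable (by fun_prop) _ _)
      intro t ht
      exact sq_le_sq' (abs_le.1 (hK t ht)).1 (abs_le.1 (hK t ht)).2
    simpa using this
  set B : ℝ := 3 / (8 * (2 * (n : ℝ) + 5) ^ 2 * (2 * n + 3) ^ 2 * (2 * n + 1)) with hB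
  have hNB : N ≤ B := legT_norm n
  have hB0 : 0 < B := by positivity
  have hcs : c ^ 2 ≤ B * K ^ 2 := by
    have h0 : 0 ≤ ∫ t in (0:ℝ)..1, (B * deriv (deriv f) t - c * legT n t) ^ 2 :=
      intervalIntegral.integral_nonneg zero_le_one fun t _ => sq_nonneg _
    have e : ∀ t, (B * deriv (deriv f) t - c * legT n t) ^ 2 =
        B ^ 2 * deriv (deriv f) t ^ 2 - (2 * B * c) * (deriv (deriv f) t * legT n t) +
          c ^ 2 * legT n t ^ 2 := by intro t; ring
    simp_rw [e] at h0
    rw [intervalIntegral.integral_add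
          (Continuous.intervalIntegrable (by fun_prop) _ _)
          (Continuous.intervalIntegrable (by fun_prop) _ _),
        intervalIntegral.integral_sub
          (Continuous.intervalIntegrable (by fun_prop) _ _)
          (Continuous.intervalIntegrable (by fun_prop) _ _)] at h0
    simp only [intervalIntegral.integral_const_mul, ← hc, ← hN, ← hA] at h0
    have i1 : c ^ 2 * N ≤ c ^ 2 * B := by gcongr
    have i2 : B ^ 2 * A ≤ B ^ 2 * K ^ 2 := by gcongr
    have : B * c ^ 2 ≤ B * (B * K ^ 2) := by nlinarith
    exact le_of_mul_le_mul_left this hB0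
  have hCc : legC f (n + 2) ^ 2 = (2 * (n : ℝ) + 5) * c ^ 2 := by
    have : legC f (n + 2) = Real.sqrt (2 * (n + 2 : ℕ) + 1) * c := by
      have e : ∀ t, f t * legendreScaling (n + 2) t =
          Real.sqrt (2 * (n + 2 : ℕ) + 1) * (f t * legQ (n + 2) t) := by
        intro t; rw [scaling_eq]; ring
      rw [legC]
      simp_rw [e]
      rw [intervalIntegral.integral_const_mul]
      congr 1
      linarith
    rw [this, mul_pow, Real.sq_sqrt (by positivity)]
    push_cast; ring
  rw [hCc]
  have hx : (0 : ℝ) ≤ n := by positivity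
  have fin : (2 * (n : ℝ) + 5) * B ≤ 3 / 8 * (1 / (2 * (n : ℝ) + 1) ^ 4) := by
    have e : (2 * (n : ℝ) + 5) * B = 3 / 8 * (1 / ((2 * (n : ℝ) + 5) * (2 * n + 3) ^ 2 *
        (2 * n + 1))) := by
      rw [hB]; field_simp
    rw [e]
    have : (2 * (n : ℝ) + 1) ^ 4 = (2 * (n : ℝ) + 1) * (2 * n + 1) ^ 2 * (2 * n + 1) := by ring
    rw [this]
    gcongr <;> norm_num
  calc (2 * (n : ℝ) + 5) * c ^ 2 ≤ (2 * (n : ℝ) + 5) * (B * K ^ 2) := by gcongr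
    _ = ((2 * (n : ℝ) + 5) * B) * K ^ 2 := by ring
    _ ≤ (3 / 8 * (1 / (2 * (n : ℝ) + 1) ^ 4)) * K ^ 2 := by gcongr
    _ = _ := by ring

lemma summable_base : Summable fun i : ℕ => 1 / (2 * (i : ℝ) + 1) ^ 4 := by
  have h : Summable fun i : ℕ => 1 / ((i + 1 : ℕ) : ℝ) ^ 4 :=
    (summable_nat_add_iff 1).2 (Real.summable_one_div_nat_pow.2 (by norm_num))
  refine Summable.of_nonneg_of_le (fun i => by positivity) (fun i => ?_) h
  have hx : (0 : ℝ) ≤ i := by positivity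
  push_cast
  gcongr
  linarith

lemma partial_bound (f : ℝ → ℝ) (hf : ContDiff ℝ 2 f) (K : ℝ)
    (hK : ∀ x ∈ Set.Icc (0:ℝ) 1, |iteratedDeriv 2 f x| ≤ K) (n : ℕ) :
    ∫ t in (0:ℝ)..1, (f t - legendrePartialSum (n + 2) f t) ^ 2 ≤
      3 * K ^ 2 / 8 * ∑' i : ℕ, 1 / (2 * ((i + n : ℕ) : ℝ) + 1) ^ 4 := by
  rw [pyth_partial f hf.continuous]
  refine le_of_forall_pos_le_add fun δ hδ => ?_
  obtain ⟨m, hm⟩ := bessel_complete f hf.continuous δ hδ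
  have hs : Summable fun i : ℕ => 1 / (2 * ((i + n : ℕ) : ℝ) + 1) ^ 4 :=
    (summable_nat_add_iff n).2 summable_base
  have h1 : ∑ i ∈ Finset.range m, legC f i ^ 2 ≤
      ∑ i ∈ Finset.range (n + 2 + m), legC f i ^ 2 :=
    Finset.sum_le_sum_of_subset_of_nonneg (Finset.range_subset_range.2 (by omega))
      fun _ _ _ => sq_nonneg _
  rw [Finset.sum_range_add] at h1
  have h2 : ∑ i ∈ Finset.range m, legC f (n + 2 + i) ^ 2 ≤
      3 * K ^ 2 / 8 * ∑' i : ℕ, 1 / (2 * ((i + n : ℕ) : ℝ) + 1) ^ 4 := by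
    calc ∑ i ∈ Finset.range m, legC f (n + 2 + i) ^ 2 
        ≤ ∑ i ∈ Finset.range m, 3 * K ^ 2 / 8 * (1 / (2 * ((i + n : ℕ) : ℝ) + 1) ^ 4) := by
          refine Finset.sum_le_sum fun i _ => ?_
          have := coeff_bound f hf K hK (i + n)
          rwa [show n + 2 + i = i + n + 2 by omega]
      _ = 3 * K ^ 2 / 8 * ∑ i ∈ Finset.range m, (1 / (2 * ((i + n : ℕ) : ℝ) + 1) ^ 4) := by
          rw [Finset.mul_sum]
      _ ≤ _ := by
          gcongr
          exact hs.sum_le_tsum _ fun i _ => by positivity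
  linarith

lemma partialSum_continuous (n : ℕ) (f : ℝ → ℝ) : Continuous (legendrePartialSum n f) := by
  have hs := scaling_continuous
  unfold legendrePartialSum
  fun_prop

lemma error_bound (g h : ℝ → ℝ) (K ν k : ℝ) (hν : 0 < ν) (hk : 0 < k)
    (hg : ContDiff ℝ 2 g) (hh : ContDiff ℝ 2 h)
    (hgK : ∀ x ∈ Set.Icc (0:ℝ) 1, |iteratedDeriv 2 g x| ≤ K)
    (hhK : ∀ x ∈ Set.Icc (0:ℝ) 1, |iteratedDeriv 2 h x| ≤ K) (n : ℕ) :
    (∫ x in (0:ℝ)..1, (ν * (g x - legendrePartialSum (n + 2) g x) +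
        k * (legendrePartialSum (n + 2) h x - h x)) ^ 2) ^ ((1:ℝ)/2) ≤
      (ν + k) * (Real.sqrt 3 * K / (2 * Real.sqrt 2)) *
        (∑' i : ℕ, 1 / (2 * ((i + n : ℕ) : ℝ) + 1) ^ 4) ^ ((1:ℝ)/2) := by
  have hK0 : 0 ≤ K := (abs_nonneg _).trans (hgK 0 (by simp))
  have c1 := partialSum_continuous (n + 2) g
  have c2 := partialSum_continuous (n + 2) h
  have c3 := hg.continuous
  have c4 := hh.continuous
  have b1 := partial_bound g hg K hgK n
  have b2 := partial_bound h hh K hhK n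
  set S := ∑' i : ℕ, 1 / (2 * ((i + n : ℕ) : ℝ) + 1) ^ 4 with hS
  have hS0 : 0 ≤ S := tsum_nonneg fun i => by positivity
  have main : ∫ x in (0:ℝ)..1, (ν * (g x - legendrePartialSum (n + 2) g x) +
        k * (legendrePartialSum (n + 2) h x - h x)) ^ 2 ≤
        ((ν + k) * (Real.sqrt 3 * K / (2 * Real.sqrt 2))) ^ 2 * S := by
    calc _ ≤ ∫ x in (0:ℝ)..1, ((ν + k) * ν * (g x - legendrePartialSum (n + 2) g x) ^ 2 +
          (ν + k) * k * (h x - legendrePartialSum (n + 2) h x) ^ 2) := by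
          apply intervalIntegral.integral_mono_on zero_le_one
            (Continuous.intervalIntegrable (by fun_prop) _ _)
            (Continuous.intervalIntegrable (by fun_prop) _ _)
          intro t _
          have := mul_nonneg (mul_nonneg hν.le hk.le)
            (sq_nonneg ((g t - legendrePartialSum (n + 2) g t) +
              (h t - legendrePartialSum (n + 2) h t)))
          linarith
      _ = (ν + k) * ν * (∫ x in (0:ℝ)..1, (g x - legendrePartialSum (n + 2) g x) ^ 2) +
          (ν + k) * k * ∫ x in (0:ℝ)..1, (h x - legendrePartialSum (n + 2) h x) ^ 2 := by
          rw [intervalIntegral.integral_add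
            (Continuous.intervalIntegrable (by fun_prop) _ _)
            (Continuous.intervalIntegrable (by fun_prop) _ _),
            intervalIntegral.integral_const_mul, intervalIntegral.integral_const_mul]
      _ ≤ (ν + k) * ν * (3 * K ^ 2 / 8 * S) + (ν + k) * k * (3 * K ^ 2 / 8 * S) := by gcongr
      _ = _ := by
          rw [mul_pow, div_pow, mul_pow, mul_pow, Real.sq_sqrt (by norm_num),
            Real.sq_sqrt (by norm_num)]
          ring
  rw [← Real.sqrt_eq_rpow, ← Real.sqrt_eq_rpow]
  refine (Real.sqrt_le_sqrt main).trans ?_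
  rw [Real.sqrt_mul (sq_nonneg _), Real.sqrt_sq (by positivity)]

/-- `L²` bound and vanishing of the error term
`εₙ = ν(gₙ - Sₙgₙ) + k(Sₙhₙ - hₙ)` for uniformly `C²`-bounded families. -/
theorem error_term_L2_bound_and_vanishes (g h : ℕ → ℝ → ℝ) (K ν k : ℝ)
    (hν : 0 < ν) (hk : 0 < k)
    (hg : ∀ n, ContDiff ℝ 2 (g n)) (hh : ∀ n, ContDiff ℝ 2 (h n))
    (hgK : ∀ n, ∀ x ∈ Set.Icc (0:ℝ) 1, |iteratedDeriv 2 (g n) x| ≤ K)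
    (hhK : ∀ n, ∀ x ∈ Set.Icc (0:ℝ) 1, |iteratedDeriv 2 (h n) x| ≤ K) :
    let ε : ℕ → ℝ → ℝ := fun n x =>
      ν * (g n x - legendrePartialSum n (g n) x) +
        k * (legendrePartialSum n (h n) x - h n x)
    (∀ n : ℕ, 2 ≤ n →
        (∫ x in (0:ℝ)..1, (ε n x) ^ 2) ^ ((1:ℝ)/2) ≤
          (ν + k) * (Real.sqrt 3 * K / (2 * Real.sqrt 2)) *
            (∑' i : ℕ, 1 / (2 * ((n : ℝ) + (i : ℝ)) - 3) ^ 4) ^ ((1:ℝ)/2)) ∧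
    Tendsto (fun n => (∫ x in (0:ℝ)..1, (ε n x) ^ 2) ^ ((1:ℝ)/2)) atTop (nhds 0) := by
  intro ε
  have hb : ∀ n : ℕ, (∫ x in (0:ℝ)..1, (ε (n + 2) x) ^ 2) ^ ((1:ℝ)/2) ≤
      (ν + k) * (Real.sqrt 3 * K / (2 * Real.sqrt 2)) *
        (∑' i : ℕ, 1 / (2 * ((i + n : ℕ) : ℝ) + 1) ^ 4) ^ ((1:ℝ)/2) := fun n =>
    error_bound (g (n + 2)) (h (n + 2)) K ν k hν hk (hg _) (hh _) (hgK _) (hhK _) n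
  constructor
  · intro n hn
    obtain ⟨m, rfl⟩ := Nat.exists_eq_add_of_le' hn
    refine (hb m).trans (le_of_eq ?_)
    congr 3
    funext i
    push_cast
    ring_nf
  · rw [← tendsto_add_atTop_iff_nat 2]
    have ht := tendsto_sum_nat_add fun i : ℕ => 1 / (2 * (i : ℝ) + 1) ^ 4
    have ht2 := (ht.rpow_const (p := (1:ℝ)/2) (Or.inr (by norm_num))).const_mul
      ((ν + k) * (Real.sqrt 3 * K / (2 * Real.sqrt 2)))
    rw [Real.zero_rpow (by norm_num), mul_zero] at ht2
    refine squeeze_zero (fun n => ?_) hb ht2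
    exact Real.rpow_nonneg
      (intervalIntegral.integral_nonneg zero_le_one fun t _ => sq_nonneg _) _
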